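/- If q(x) ∈ ℤ[x] is the rook polynomial of an increasing Ferrers board, then that increasing Ferrers board is unique: any two increasing Ferrers boards whose rook polynomial equals q(x) have the same height vector (up to columns of zero height). -/

import Mathlib

open Polynomial

/-- A board is a finite subset of ℕ × ℕ.  `rookNum B k` is the number of placements of `k`
non-attacking rooks on `B`. -/
def rookNum (B : Finset (ℕ × ℕ)) (k : ℕ) : ℕ :=
  (B.powerset.filter (fun P => P.card = k ∧
    ∀ p ∈ P, ∀ q ∈ P, p ≠ q → p.1 ≠ q.1 ∧ p.2 ≠ q.2)).card

/-- The Ferrers board with `c` columns of heights `h 1, …, h c`. -/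
def ferrersBoard (c : ℕ) (h : ℕ → ℕ) : Finset (ℕ × ℕ) :=
  (Finset.Icc 1 c).biUnion (fun i => ({i} : Finset ℕ) ×ˢ Finset.Icc 1 (h i))

/-- The list of nonzero column heights of the Ferrers board with heights `h 1, …, h c`;
two height vectors agree "up to columns of zero height" iff these lists agree. -/
def nonzeroHeights (c : ℕ) (h : ℕ → ℕ) : List ℕ :=
  ((List.range c).map (fun i => h (i + 1))).filter (fun x => x != 0)

/-- The placements of `k` non-attacking rooks on `B`. -/
def rookPlacements (B : Finset (ℕ × ℕ)) (k : ℕ) : Finset (Finset (ℕ × ℕ)) :=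
  B.powerset.filter (fun P => P.card = k ∧
    ∀ p ∈ P, ∀ q ∈ P, p ≠ q → p.1 ≠ q.1 ∧ p.2 ≠ q.2)

lemma mem_rookPlacements {B P : Finset (ℕ × ℕ)} {k : ℕ} :
    P ∈ rookPlacements B k ↔ P ⊆ B ∧ P.card = k ∧
      ∀ p ∈ P, ∀ q ∈ P, p ≠ q → p.1 ≠ q.1 ∧ p.2 ≠ q.2 := by
  simp [rookPlacements]

lemma card_rookPlacements (B : Finset (ℕ × ℕ)) (k : ℕ) :
    (rookPlacements B k).card = rookNum B k := rfl

lemma card_image_snd_of_mem_rookPlacements {B P : Finset (ℕ × ℕ)} {k : ℕ}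
    (hP : P ∈ rookPlacements B k) : (P.image Prod.snd).card = k := by
  obtain ⟨-, hk, hP⟩ := mem_rookPlacements.1 hP
  rw [Finset.card_image_of_injOn, hk]
  intro p hp q hq hpq
  by_contra hne
  exact (hP p hp q hq hne).2 hpq

lemma rookNum_zero (B : Finset (ℕ × ℕ)) : rookNum B 0 = 1 := by
  rw [← card_rookPlacements, Finset.card_eq_one]
  refine ⟨∅, ?_⟩
  ext P
  simp only [mem_rookPlacements, Finset.card_eq_zero, Finset.mem_singleton]
  constructor
  · exact fun h => h.2.1
  · rintro rfl
    simp

lemma rookNum_empty_succ (k : ℕ) : rookNum ∅ (k + 1) = 0 := by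
  rw [← card_rookPlacements, Finset.card_eq_zero, Finset.eq_empty_iff_forall_notMem]
  intro P hP
  obtain ⟨h, hk, -⟩ := mem_rookPlacements.1 hP
  simp [Finset.subset_empty.1 h] at hk

lemma rookPlacements_union_column {B : Finset (ℕ × ℕ)} {c h : ℕ} (hc : ∀ p ∈ B, p.1 ≠ c)
    (k : ℕ) :
    rookPlacements (B ∪ {c} ×ˢ Finset.Icc 1 h) (k + 1) = rookPlacements B (k + 1) ∪
      ((rookPlacements B k).sigma fun P => Finset.Icc 1 h \ P.image Prod.snd).image
        fun x => insert (c, x.2) x.1 := by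
  ext P
  simp only [Finset.mem_union, Finset.mem_image, Finset.mem_sigma, Sigma.exists,
    mem_rookPlacements]
  constructor
  · rintro ⟨hPB, hk, hP⟩
    by_cases hcol : ∃ j, (c, j) ∈ P
    · right
      obtain ⟨j, hj⟩ := hcol
      refine ⟨P.erase (c, j), j, ⟨⟨?_, ?_, ?_⟩, ?_⟩, Finset.insert_erase hj⟩
      · intro p hp
        obtain ⟨hne, hp⟩ := Finset.mem_erase.1 hp
        rcases Finset.mem_union.1 (hPB hp) with h | h
        · exact h
        · simp only [Finset.mem_product, Finset.mem_singleton] at h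
          exact absurd h.1 (hP p hp _ hj hne).1
      · rw [Finset.card_erase_of_mem hj, hk, Nat.add_sub_cancel]
      · exact fun p hp q hq => hP p (Finset.mem_of_mem_erase hp) q (Finset.mem_of_mem_erase hq)
      · rw [Finset.mem_sdiff]
        constructor
        · rcases Finset.mem_union.1 (hPB hj) with h | h
          · exact absurd rfl (hc _ h)
          · exact (Finset.mem_product.1 h).2
        · intro hmem
          obtain ⟨p, hp, hpj⟩ := Finset.mem_image.1 hmem
          obtain ⟨hne, hp⟩ := Finset.mem_erase.1 hp
          exact (hP p hp _ hj hne).2 hpj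
    · left
      refine ⟨fun p hp => ?_, hk, hP⟩
      rcases Finset.mem_union.1 (hPB hp) with h | h
      · exact h
      · simp only [Finset.mem_product, Finset.mem_singleton] at h
        exact absurd ⟨p.2, h.1 ▸ hp⟩ hcol
  · rintro (⟨hPB, hk, hP⟩ | ⟨Q, j, ⟨⟨hQB, hk, hQ⟩, hj⟩, rfl⟩)
    · exact ⟨hPB.trans Finset.subset_union_left, hk, hP⟩
    · rw [Finset.mem_sdiff] at hj
      have hjQ : ∀ p ∈ Q, p.2 ≠ j := fun p hp hpj => hj.2 (Finset.mem_image.2 ⟨p, hp, hpj⟩)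
      refine ⟨?_, ?_, ?_⟩
      · refine Finset.insert_subset (Finset.mem_union_right _ ?_)
          (hQB.trans Finset.subset_union_left)
        exact Finset.mem_product.2 ⟨Finset.mem_singleton_self c, hj.1⟩
      · rw [Finset.card_insert_of_notMem fun hm => hjQ _ hm rfl, hk]
      · intro p hp q hq hne
        rcases Finset.mem_insert.1 hp with rfl | hp <;> rcases Finset.mem_insert.1 hq with rfl | hq
        · exact absurd rfl hne
        · exact ⟨(hc q (hQB hq)).symm, (hjQ q hq).symm⟩
        · exact ⟨hc p (hQB hp), hjQ p hp⟩
        · exact hQ p hp q hq hne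

/-- Adding a new column at least as high as every row in use. -/
lemma rookNum_union_column {B : Finset (ℕ × ℕ)} {c h : ℕ} (hc : ∀ p ∈ B, p.1 ≠ c)
    (hrow : ∀ p ∈ B, p.2 ∈ Finset.Icc 1 h) (k : ℕ) :
    (rookNum (B ∪ {c} ×ˢ Finset.Icc 1 h) (k + 1) : ℤ) =
      rookNum B (k + 1) + (h - k) * rookNum B k := by
  have hnot : ∀ P ∈ rookPlacements B k, ∀ j, (c, j) ∉ P := fun P hP j hj =>
    hc _ ((mem_rookPlacements.1 hP).1 hj) rfl
  rw [← card_rookPlacements, rookPlacements_union_column hc, Finset.card_union_of_disjoint,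
    Finset.card_image_of_injOn, Finset.card_sigma]
  · push_cast
    rw [card_rookPlacements, Finset.sum_congr rfl (g := fun _ => (h : ℤ) - k), Finset.sum_const,
      card_rookPlacements, nsmul_eq_mul, mul_comm]
    intro P hP
    have hsub : P.image Prod.snd ⊆ Finset.Icc 1 h := by
      intro j hj
      obtain ⟨p, hp, rfl⟩ := Finset.mem_image.1 hj
      exact hrow p ((mem_rookPlacements.1 hP).1 hp)
    have hcard := card_image_snd_of_mem_rookPlacements hP
    have hle := Finset.card_le_card hsub
    rw [Finset.card_sdiff_of_subset hsub, Nat.cast_sub hle, hcard, Nat.card_Icc,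
      Nat.add_sub_cancel]
  · rintro ⟨P, i⟩ hP ⟨Q, j⟩ hQ heq
    simp only [Finset.coe_sigma, Set.mem_sigma_iff, Finset.mem_coe] at hP hQ
    dsimp only at heq
    have hi : (c, i) ∈ insert (c, j) Q := heq ▸ Finset.mem_insert_self _ _
    have hij : i = j := by
      rcases Finset.mem_insert.1 hi with h | h
      · exact congrArg Prod.snd h
      · exact absurd h (hnot Q hQ.1 i)
    subst hij
    have hPQ : P = Q := by
      rw [← Finset.erase_insert (hnot P hP.1 i), heq, Finset.erase_insert (hnot Q hQ.1 i)]
    rw [hPQ]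
  · rw [Finset.disjoint_left]
    intro P hP hP'
    obtain ⟨⟨Q, j⟩, -, rfl⟩ := Finset.mem_image.1 hP'
    exact hc _ ((mem_rookPlacements.1 hP).1 (Finset.mem_insert_self _ _)) rfl

lemma mem_ferrersBoard {c : ℕ} {h : ℕ → ℕ} {p : ℕ × ℕ} :
    p ∈ ferrersBoard c h ↔ p.1 ∈ Finset.Icc 1 c ∧ p.2 ∈ Finset.Icc 1 (h p.1) := by
  simp only [ferrersBoard, Finset.mem_biUnion, Finset.mem_product, Finset.mem_singleton]
  aesop

lemma ferrersBoard_succ (c : ℕ) (h : ℕ → ℕ) :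
    ferrersBoard (c + 1) h = ferrersBoard c h ∪ {c + 1} ×ˢ Finset.Icc 1 (h (c + 1)) := by
  rw [ferrersBoard, ← Finset.insert_Icc_right_eq_Icc_add_one (by omega),
    Finset.biUnion_insert, Finset.union_comm, ferrersBoard]

/-- The effect on the sequence of rook numbers of adding a new highest column of height `a`. -/
def addColumn (f : ℕ → ℤ) (a : ℕ) : ℕ → ℤ
  | 0 => f 0
  | k + 1 => f (k + 1) + (a - k) * f k

/-- The rook numbers of the Ferrers board with the given list of column heights. -/
def rookSeq (l : List ℕ) : ℕ → ℤ :=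
  l.foldl addColumn fun k => if k = 0 then 1 else 0

lemma rookSeq_concat (l : List ℕ) (a : ℕ) : rookSeq (l ++ [a]) = addColumn (rookSeq l) a := by
  simp [rookSeq]

lemma nonzeroHeights_succ (c : ℕ) (h : ℕ → ℕ) :
    nonzeroHeights (c + 1) h =
      nonzeroHeights c h ++ if h (c + 1) = 0 then [] else [h (c + 1)] := by
  by_cases h0 : h (c + 1) = 0 <;> simp [nonzeroHeights, List.range_succ, h0]

lemma rookNum_ferrersBoard (c : ℕ) (h : ℕ → ℕ)
    (hinc : ∀ i j, 1 ≤ i → i < j → j ≤ c → h i < h j) (k : ℕ) :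
    (rookNum (ferrersBoard c h) k : ℤ) = rookSeq (nonzeroHeights c h) k := by
  induction c generalizing k with
  | zero =>
    cases k with
    | zero => simp [rookNum_zero, rookSeq, nonzeroHeights]
    | succ k => simp [ferrersBoard, rookNum_empty_succ, rookSeq, nonzeroHeights]
  | succ c ih =>
    have ih := ih fun i j hi hij hj => hinc i j hi hij (by omega)
    rw [nonzeroHeights_succ, ferrersBoard_succ]
    split_ifs with h0
    · simpa [h0] using ih k
    · rw [rookSeq_concat]
      cases k with
      | zero => rw [addColumn, ← ih, rookNum_zero, rookNum_zero]
      | succ k =>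
        rw [rookNum_union_column, addColumn, ih, ih]
        · intro p hp
          have := Finset.mem_Icc.1 (mem_ferrersBoard.1 hp).1
          omega
        · intro p hp
          rw [mem_ferrersBoard, Finset.mem_Icc, Finset.mem_Icc] at hp
          have := hinc p.1 (c + 1) hp.1.1 (by omega) le_rfl
          rw [Finset.mem_Icc]
          omega

lemma rookSeq_eq_zero_of_length_lt (l : List ℕ) {k : ℕ} (hk : l.length < k) :
    rookSeq l k = 0 := by
  induction l using List.reverseRecOn generalizing k with
  | nil => simp [rookSeq, (show k ≠ 0 by simp at hk; omega)]
  | append_singleton l a ih =>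
    rw [List.length_append, List.length_singleton] at hk
    obtain ⟨k, rfl⟩ := Nat.exists_eq_succ_of_ne_zero (show k ≠ 0 by omega)
    rw [rookSeq_concat, addColumn, ih (by omega), ih (by omega)]
    simp

lemma length_lt_of_pairwise_concat {l : List ℕ} {a : ℕ} (hl : (l ++ [a]).Pairwise (· < ·))
    (hpos : ∀ x ∈ l ++ [a], 0 < x) : l.length < a := by
  induction l using List.reverseRecOn generalizing a with
  | nil => simpa using hpos
  | append_singleton l b ih =>
    have hb := ih (hl.sublist (List.sublist_append_left _ _))
      fun x hx => hpos x (List.mem_append_left _ hx)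
    have := (List.pairwise_append.1 hl).2.2 b (by simp) a (by simp)
    simp only [List.length_append, List.length_singleton]
    omega

lemma rookSeq_length_pos {l : List ℕ} (hl : l.Pairwise (· < ·)) (hpos : ∀ x ∈ l, 0 < x) :
    0 < rookSeq l l.length := by
  induction l using List.reverseRecOn with
  | nil => simp [rookSeq]
  | append_singleton l a ih =>
    have ha := length_lt_of_pairwise_concat hl hpos
    have := ih (hl.sublist (List.sublist_append_left _ _))
      fun x hx => hpos x (List.mem_append_left _ hx)
    rw [List.length_append, List.length_singleton, rookSeq_concat, addColumn,
      rookSeq_eq_zero_of_length_lt l (Nat.lt_succ_self _), zero_add]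
    exact mul_pos (by omega) this

/-- The differences between the heights of the columns and the heights of a staircase. -/
def staircaseDiff (l : List ℕ) : List ℤ :=
  l.mapIdx fun (i a : ℕ) => (a : ℤ) - i

/-- The Goldman–Joichi–White factorization theorem. -/
lemma sum_rookSeq_mul_descPochhammer (l : List ℕ) :
    ∑ k ∈ Finset.range (l.length + 1), C (rookSeq l k) * descPochhammer ℤ (l.length - k) =
      ((staircaseDiff l).map fun d => X + C d).prod := by
  induction l using List.reverseRecOn with
  | nil => simp [rookSeq, staircaseDiff]
  | append_singleton l a ih =>
    rw [staircaseDiff, List.mapIdx_concat, ← staircaseDiff, List.map_append, List.prod_append,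
      ← ih, List.length_append, List.length_singleton, rookSeq_concat, Finset.sum_range_succ',
      Finset.sum_mul]
    simp only [addColumn, List.map_cons, List.map_nil, List.prod_singleton, C_add, C_mul,
      add_mul, Finset.sum_add_distrib, Nat.add_sub_add_right]
    have hshift : ∑ k ∈ Finset.range (l.length + 1),
          C (rookSeq l (k + 1)) * descPochhammer ℤ (l.length - k) +
          C (rookSeq l 0) * descPochhammer ℤ (l.length + 1 - 0) =
        ∑ k ∈ Finset.range (l.length + 1),
          C (rookSeq l k) * descPochhammer ℤ (l.length + 1 - k) := by
      rw [Finset.sum_range_succ, rookSeq_eq_zero_of_length_lt l (Nat.lt_succ_self _),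
        C_0, zero_mul, add_zero, Finset.sum_range_succ']
      simp only [Nat.add_sub_add_right]
    rw [add_right_comm, hshift, ← Finset.sum_add_distrib]
    refine Finset.sum_congr rfl fun k hk => ?_
    have hk : k ≤ l.length := Nat.lt_succ_iff.1 (Finset.mem_range.1 hk)
    rw [Nat.succ_sub hk, descPochhammer_succ_right]
    simp only [C_sub, Nat.cast_sub hk, map_natCast]
    ring

lemma staircaseDiff_injective : Function.Injective staircaseDiff := by
  intro l₁ l₂ h
  have hlen : l₁.length = l₂.length := by simpa [staircaseDiff] using congrArg List.length h
  refine List.ext_getElem hlen fun i h₁ h₂ => ?_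
  have hi : (staircaseDiff l₁)[i]? = (staircaseDiff l₂)[i]? := by rw [h]
  simpa [staircaseDiff, h₁, h₂] using hi

lemma pairwise_staircaseDiff {l : List ℕ} (hl : l.Pairwise (· < ·)) :
    (staircaseDiff l).Pairwise (· ≤ ·) := by
  rw [← List.isChain_iff_pairwise] at hl ⊢
  rw [List.isChain_iff_getElem] at hl ⊢
  intro i hi
  simp only [staircaseDiff, List.length_mapIdx] at hi
  have := hl i hi
  simp only [staircaseDiff, List.getElem_mapIdx]
  push_cast
  omega

lemma eq_of_rookSeq_eq {l₁ l₂ : List ℕ} (hl₁ : l₁.Pairwise (· < ·)) (hl₂ : l₂.Pairwise (· < ·))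
    (hpos₁ : ∀ x ∈ l₁, 0 < x) (hpos₂ : ∀ x ∈ l₂, 0 < x) (h : rookSeq l₁ = rookSeq l₂) :
    l₁ = l₂ := by
  have hlen : l₁.length = l₂.length := by
    refine le_antisymm ?_ ?_ <;> by_contra! hlt
    · exact (rookSeq_length_pos hl₁ hpos₁).ne' (h ▸ rookSeq_eq_zero_of_length_lt l₂ hlt)
    · exact (rookSeq_length_pos hl₂ hpos₂).ne' (h ▸ rookSeq_eq_zero_of_length_lt l₁ hlt)
  have hprod := sum_rookSeq_mul_descPochhammer l₁
  rw [h, hlen, sum_rookSeq_mul_descPochhammer l₂] at hprod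
  have hroots (m : List ℤ) :
      (m.map fun d => X + C d).prod.roots = (m.map Neg.neg : Multiset ℤ) := by
    rw [← Polynomial.roots_multiset_prod_X_sub_C (m.map Neg.neg : Multiset ℤ)]
    simp [Function.comp_def]
  have hperm := congrArg Polynomial.roots hprod
  rw [hroots, hroots, Multiset.coe_eq_coe, List.map_perm_map_iff neg_injective] at hperm
  exact staircaseDiff_injective
    (hperm.symm.eq_of_pairwise' (pairwise_staircaseDiff hl₁) (pairwise_staircaseDiff hl₂))

lemma pairwise_nonzeroHeights {c : ℕ} {h : ℕ → ℕ}
    (hinc : ∀ i j, 1 ≤ i → i < j → j ≤ c → h i < h j) :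
    (nonzeroHeights c h).Pairwise (· < ·) := by
  refine List.Pairwise.filter _ (List.pairwise_map.2 ?_)
  refine (List.pairwise_lt_range (n := c)).imp_of_mem fun {i j} _ hj hij => ?_
  exact hinc _ _ (by omega) (by omega) (List.mem_range.1 hj)

lemma pos_of_mem_nonzeroHeights {c : ℕ} {h : ℕ → ℕ} {x : ℕ} (hx : x ∈ nonzeroHeights c h) :
    0 < x := by
  have := (List.mem_filter.1 hx).2
  exact Nat.pos_of_ne_zero (by simpa using this)

/-- An increasing Ferrers board is determined by its rook polynomial: any two increasing
Ferrers boards whose rook polynomials both equal `q(x)` have the same height vector, up to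
columns of zero height. -/
theorem increasing_ferrers_unique (q : Polynomial ℤ) (c₁ c₂ : ℕ) (h₁ h₂ : ℕ → ℕ)
    (hinc₁ : ∀ i j, 1 ≤ i → i < j → j ≤ c₁ → h₁ i < h₁ j)
    (hinc₂ : ∀ i j, 1 ≤ i → i < j → j ≤ c₂ → h₂ i < h₂ j)
    (hq₁ : ∀ k, q.coeff k = (rookNum (ferrersBoard c₁ h₁) k : ℤ))
    (hq₂ : ∀ k, q.coeff k = (rookNum (ferrersBoard c₂ h₂) k : ℤ)) :
    nonzeroHeights c₁ h₁ = nonzeroHeights c₂ h₂ := by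
  refine eq_of_rookSeq_eq (pairwise_nonzeroHeights hinc₁) (pairwise_nonzeroHeights hinc₂)
    (fun _ => pos_of_mem_nonzeroHeights) (fun _ => pos_of_mem_nonzeroHeights) ?_
  funext k
  rw [← rookNum_ferrersBoard c₁ h₁ hinc₁, ← rookNum_ferrersBoard c₂ h₂ hinc₂, ← hq₁, hq₂]
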